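/- Let n, b : ℕ. Then the number of functions f : Fin n → Fin b that have some bin with more than ⌈n/2⌉ particles, i.e. the cardinality of {f : Fin n → Fin b | ∃ j : Fin b, (Finset.univ.filter (fun x => f x = j)).card > (n + 1) / 2}, equals b * ∑ k ∈ Finset.Icc ((n + 1) / 2 + 1) n, Nat.choose n k * (b - 1) ^ (n - k), where (n+1)/2 denotes natural-number division (so (n+1)/2 = ⌈n/2⌉). -/

import Mathlib

theorem cbm_fiber (n b : ℕ) (j : Fin b) (S : Finset (Fin n)) :
    (Finset.univ.filter (fun f : Fin n → Fin b =>
      Finset.univ.filter (fun x : Fin n => f x = j) = S)).card = (b - 1) ^ (n - S.card) := by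
  have h : (Finset.univ.filter (fun f : Fin n → Fin b =>
      Finset.univ.filter (fun x : Fin n => f x = j) = S))
      = Fintype.piFinset (fun x => if x ∈ S then {j} else Finset.univ.erase j) := by
    ext f
    simp only [Finset.mem_filter, Finset.mem_univ, true_and, Fintype.mem_piFinset,
      Finset.ext_iff]
    refine forall_congr' fun x => ?_
    by_cases hx : x ∈ S <;> simp [hx]
  rw [h, Fintype.card_piFinset]
  have h2 : ∀ x : Fin n, (if x ∈ S then {j} else Finset.univ.erase j : Finset (Fin b)).card
      = if x ∈ S then 1 else b - 1 := by
    intro x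
    split_ifs <;> simp [Finset.card_erase_of_mem]
  simp only [h2]
  rw [Finset.prod_ite]
  simp only [Finset.prod_const_one, one_mul, Finset.prod_const]
  congr 1
  have h3 : (Finset.univ.filter (fun x : Fin n => x ∉ S)) = Sᶜ := by
    ext x; simp
  rw [h3, Finset.card_compl, Fintype.card_fin]

theorem cbm_bin (n b m : ℕ) (j : Fin b) :
    (Finset.univ.filter (fun f : Fin n → Fin b =>
      (Finset.univ.filter (fun x : Fin n => f x = j)).card > m)).card
      = ∑ k ∈ Finset.Icc (m + 1) n, Nat.choose n k * (b - 1) ^ (n - k) := by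
  have key : ∀ k, (Finset.univ.filter (fun f : Fin n → Fin b =>
      (Finset.univ.filter (fun x : Fin n => f x = j)).card = k)).card
      = Nat.choose n k * (b - 1) ^ (n - k) := by
    intro k
    rw [Finset.card_eq_sum_card_fiberwise
      (f := fun f : Fin n → Fin b => Finset.univ.filter (fun x : Fin n => f x = j))
      (t := Finset.powersetCard k Finset.univ)]
    · rw [Finset.sum_congr rfl (g := fun _ => (b - 1) ^ (n - k))]
      · simp
      · intro S hS
        have hk := (Finset.mem_powersetCard.1 hS).2
        rw [← hk, ← cbm_fiber n b j S, Finset.filter_filter]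
        congr 1
        ext f
        simp only [Finset.mem_filter, Finset.mem_univ, true_and]
        exact ⟨fun h => h.2, fun h => ⟨by rw [h], h⟩⟩
    · intro f hf
      simpa [Finset.mem_powersetCard] using hf
  rw [Finset.card_eq_sum_card_fiberwise
      (f := fun f : Fin n → Fin b => (Finset.univ.filter (fun x : Fin n => f x = j)).card)
      (t := Finset.Icc (m + 1) n)]
  · refine Finset.sum_congr rfl fun k hk => ?_
    rw [← key, Finset.filter_filter]
    congr 1
    ext f
    simp only [Finset.mem_filter, Finset.mem_univ, true_and]
    have := Finset.mem_Icc.1 hk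
    constructor
    · exact fun h => h.2
    · intro h; exact ⟨by omega, h⟩
  · intro f hf
    have h1 : (Finset.univ.filter (fun x : Fin n => f x = j)).card ≤ n := by
      simpa using Finset.card_le_univ (Finset.univ.filter (fun x : Fin n => f x = j))
    have h2 := (Finset.mem_filter.1 (Finset.mem_coe.1 hf)).2
    exact Finset.mem_coe.2 (Finset.mem_Icc.2 ⟨h2, h1⟩)

/-- The number of ways for `n` particles to land in `b` time bins such that some bin
contains more than `⌈n/2⌉` particles is
`b · ∑_{k=⌈n/2⌉+1}^{n} C(n,k) (b-1)^(n-k)`. -/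
theorem count_bin_with_majority (n b : ℕ) :
    Nat.card {f : Fin n → Fin b | ∃ j : Fin b,
        (Finset.univ.filter (fun x : Fin n => f x = j)).card > (n + 1) / 2}
      = b * ∑ k ∈ Finset.Icc ((n + 1) / 2 + 1) n,
          Nat.choose n k * (b - 1) ^ (n - k) := by
  classical
  have h : {f : Fin n → Fin b | ∃ j : Fin b,
        (Finset.univ.filter (fun x : Fin n => f x = j)).card > (n + 1) / 2}
      = ((Finset.univ.biUnion fun j : Fin b => Finset.univ.filter (fun f : Fin n → Fin b =>
      (Finset.univ.filter (fun x : Fin n => f x = j)).card > (n + 1) / 2) :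
        Finset (Fin n → Fin b)) : Set (Fin n → Fin b)) := by
    ext f; simp
  rw [h, Nat.card_coe_set_eq, Set.ncard_coe_finset, Finset.card_biUnion]
  · simp only [cbm_bin]
    simp
  · intro i _ j _ hij
    rw [Function.onFun, Finset.disjoint_left]
    intro f hi hj
    have hi := (Finset.mem_filter.1 hi).2
    have hj := (Finset.mem_filter.1 hj).2
    have hd : Disjoint (Finset.univ.filter (fun x : Fin n => f x = i))
        (Finset.univ.filter (fun x : Fin n => f x = j)) := by
      rw [Finset.disjoint_left]
      intro x hx hx'
      exact hij ((Finset.mem_filter.1 hx).2.symm.trans (Finset.mem_filter.1 hx').2)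
    have h1 := Finset.card_union_of_disjoint hd
    have h2 := Finset.card_le_univ (Finset.univ.filter (fun x : Fin n => f x = i) ∪
        Finset.univ.filter (fun x : Fin n => f x = j))
    rw [Fintype.card_fin] at h2
    omega
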